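/- arXiv:1606.00652 — 7 statements merged into one kernel-verified Lean document; each statement's English description precedes it below -/
import Mathlib

section
/- Equivalence of semimeasure-death and death-state: Let μ be an environment semimeasure over percept set E and μ' its equivalent death-state environment over percept set E_d = E ∪ {e^d} with death-reward r(e^d) = 0. Then for every policy π on histories over A × E_d and every history h over A × E (containing no occurrence of e^d) with μ(h) > 0, V_{μ'}^π(h) = V_μ^{π̃}(h), where π̃ is the restriction of π to histories over A × E. -/
open scoped BigOperators

/-- A history is a finite list of action–percept pairs. -/
abbrev Hist (A E : Type) := List (A × E)

/-- An environment semimeasure: values in [0,1], mass 1 on the empty history,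
and the mass of one-step extensions does not exceed the mass of the history. -/
def IsEnvSemimeasure {A E : Type} [Fintype E] (ν : Hist A E → ℝ) : Prop :=
  (∀ h : Hist A E, 0 ≤ ν h ∧ ν h ≤ 1) ∧ ν ([] : Hist A E) = 1 ∧
    ∀ (h : Hist A E) (a : A), (∑ e : E, ν (h ++ [(a, e)])) ≤ ν h

/-- Conditional probability ν(e | h, a). -/
noncomputable def condProb {A E : Type} (ν : Hist A E → ℝ) (h : Hist A E) (a : A) (e : E) : ℝ :=
  ν (h ++ [(a, e)]) / ν h

/-- Instantaneous measure loss L_ν(h, a). -/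
noncomputable def measLoss {A E : Type} [Fintype E] (ν : Hist A E → ℝ) (h : Hist A E) (a : A) : ℝ :=
  1 - ∑ e : E, condProb ν h a e
/-- Extend a history by a list of percepts, with actions chosen by the policy π. -/
def extendHist {A E : Type} (π : Hist A E → A) : Hist A E → List E → Hist A E
  | h, [] => h
  | h, e :: es => extendHist π (h ++ [(π h, e)]) es

/-- The summed discount Γ_t = Σ_{k ≥ t} γ_k. -/
noncomputable def Γtail (γ : ℕ → ℝ) (t : ℕ) : ℝ := ∑' k : ℕ, γ (t + k)

/-- The value V_ν^π(h) of policy π in environment ν given history h: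
(1/Γ_t) Σ_{k ≥ t} Σ_{e_t..e_k} γ_k r(e_k) ν(h ++ extension)/ν(h), t = |h| (0-indexed). -/
noncomputable def value {A E : Type} [Fintype E] (γ : ℕ → ℝ) (r : E → ℝ)
    (ν : Hist A E → ℝ) (π : Hist A E → A) (h : Hist A E) : ℝ :=
  (Γtail γ h.length)⁻¹ *
    ∑' n : ℕ, ∑ es : Fin (n + 1) → E,
      γ (h.length + n) * r (es (Fin.last n)) * ν (extendHist π h (List.ofFn es)) / ν h

/-- V_ν^π(h, a): value with the first action fixed to `a` and subsequent actions by π. -/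
noncomputable def valueAct {A E : Type} [Fintype E] [DecidableEq A] [DecidableEq E]
    (γ : ℕ → ℝ) (r : E → ℝ) (ν : Hist A E → ℝ) (π : Hist A E → A)
    (h : Hist A E) (a : A) : ℝ :=
  value γ r ν (fun h' => if h' = h then a else π h') h

/-- Optimal value V*_ν(h, a) := sup over policies of V_ν^π(h, a). -/
noncomputable def vStar {A E : Type} [Fintype E] [DecidableEq A] [DecidableEq E]
    (γ : ℕ → ℝ) (r : E → ℝ) (ν : Hist A E → ℝ) (h : Hist A E) (a : A) : ℝ :=
  ⨆ π : Hist A E → A, valueAct γ r ν π h a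
/-- Strip the death-percept structure: a history over `A × Option E` with no `none`
corresponds to the history over `A × E` obtained by removing the `some`s. -/
def strip {A E : Type} (h : Hist A (Option E)) : Hist A E :=
  h.filterMap (fun p => p.2.map (fun e => (p.1, e)))

/-- Embed an ordinary history over `A × E` into histories over `A × Option E`
(where `none` plays the role of the death-percept `e^d`). -/
def embed {A E : Type} (h : Hist A E) : Hist A (Option E) :=
  h.map (fun p => (p.1, some p.2))

/-- Conditional probabilities of the equivalent death-state environment μ':
if the history contains the death-percept `none`, the death-percept recurs with
probability 1; otherwise percepts in E keep their μ-probability and the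
death-percept gets the μ-measure loss. -/
noncomputable def deathCond {A E : Type} [Fintype E] [DecidableEq A] [DecidableEq E]
    (μ : Hist A E → ℝ) (h : Hist A (Option E)) (a : A) : Option E → ℝ
  | Option.none =>
      if (Option.none : Option E) ∈ h.map Prod.snd then 1 else measLoss μ (strip h) a
  | Option.some e =>
      if (Option.none : Option E) ∈ h.map Prod.snd then 0 else condProb μ (strip h) a e

noncomputable def deathEnvAux {A E : Type} [Fintype E] [DecidableEq A] [DecidableEq E]
    (μ : Hist A E → ℝ) : List (A × Option E) → ℝ
  | [] => 1
  | (a, e) :: rest => deathEnvAux μ rest * deathCond μ rest.reverse a e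

/-- The equivalent death-state environment μ': μ'([]) = 1 and
μ'(h ++ [(a,e)]) = μ'(h) · μ'(e | h, a) with conditionals `deathCond`. -/
noncomputable def deathEnv {A E : Type} [Fintype E] [DecidableEq A] [DecidableEq E]
    (μ : Hist A E → ℝ) (h : Hist A (Option E)) : ℝ :=
  deathEnvAux μ h.reverse

section helpers
variable {A E : Type}

theorem ds_extend_snd (π : Hist A E → A) (es : List E) :
    ∀ h : Hist A E, (extendHist π h es).map Prod.snd = h.map Prod.snd ++ es := by
  induction es with
  | nil => intro h; simp [extendHist]
  | cons e es ih => intro h; simp [extendHist, ih]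

theorem ds_extend_snoc (π : Hist A E → A) (es : List E) (e : E) :
    ∀ h : Hist A E, extendHist π h (es ++ [e]) =
      extendHist π h es ++ [(π (extendHist π h es), e)] := by
  induction es with
  | nil => intro h; simp [extendHist]
  | cons e' es ih => intro h; simp [extendHist, ih]

theorem ds_extend_embed (π : Hist A (Option E) → A) (es : List E) :
    ∀ h : Hist A E, extendHist π (embed h) (es.map some) =
      embed (extendHist (fun h' => π (embed h')) h es) := by
  induction es with
  | nil => intro h; simp [extendHist]
  | cons e es ih =>
    intro h
    have h1 : embed h ++ [(π (embed h), some e)] = embed (h ++ [(π (embed h), e)]) := by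
      simp [embed]
    simp only [extendHist, List.map_cons]
    rw [h1, ih]

theorem ds_strip_embed (h : Hist A E) : strip (embed h) = h := by
  induction h with
  | nil => rfl
  | cons p h ih =>
    simp only [strip, embed] at ih
    simp [strip, embed, ih]

theorem ds_none_embed (h : Hist A E) : (none : Option E) ∉ (embed h).map Prod.snd := by
  simp [embed]

variable [Fintype E] [DecidableEq A] [DecidableEq E]

theorem ds_env_snoc (μ : Hist A E → ℝ) (h : Hist A (Option E)) (a : A) (e : Option E) :
    deathEnv μ (h ++ [(a, e)]) = deathEnv μ h * deathCond μ h a e := by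
  simp [deathEnv, deathEnvAux]

theorem ds_env_embed (μ : Hist A E → ℝ) (hμ : IsEnvSemimeasure μ) (h : Hist A E) :
    deathEnv μ (embed h) = μ h := by
  induction h using List.reverseRecOn with
  | nil => simp [embed, deathEnv, deathEnvAux, hμ.2.1]
  | append_singleton h p ih =>
    obtain ⟨a, e⟩ := p
    have h1 : embed (h ++ [(a, e)]) = embed h ++ [(a, some e)] := by simp [embed]
    rw [h1, ds_env_snoc, ih]
    simp only [deathCond, if_neg (ds_none_embed h), ds_strip_embed, condProb]
    by_cases h0 : μ h = 0
    · have h2 := hμ.2.2 h a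
      have h3 : μ (h ++ [(a, e)]) ≤ ∑ e : E, μ (h ++ [(a, e)]) :=
        Finset.single_le_sum (f := fun e => μ (h ++ [(a, e)]))
          (fun i _ => (hμ.1 _).1) (Finset.mem_univ e)
      have h4 := (hμ.1 (h ++ [(a, e)])).1
      rw [h0]
      linarith
    · field_simp

end helpers

/-- Equivalence of semimeasure-death and death-state: for every
policy π over histories with the death-percept (`none`, with death-reward 0)
and every death-free history h with μ(h) > 0, the value of π in the equivalent
death-state environment μ' equals the value in μ of the restriction of π to
ordinary histories. -/
theorem deathstate_value_equivalence
    {A E : Type} [Fintype A] [Nonempty A] [Fintype E] [Nonempty E]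
    [DecidableEq A] [DecidableEq E]
    (γ : ℕ → ℝ) (hγpos : ∀ t, 0 < γ t) (hγsum : Summable γ)
    (r : E → ℝ)
    (μ : Hist A E → ℝ) (hμ : IsEnvSemimeasure μ)
    (π : Hist A (Option E) → A)
    (h : Hist A E) (hpos : 0 < μ h) :
    value γ (fun e : Option E => e.elim 0 r) (deathEnv μ) π (embed h)
      = value γ r μ (fun h' => π (embed h')) h := by
  have hlen : (embed h).length = h.length := by simp [embed]
  unfold value
  rw [hlen, ds_env_embed μ hμ h]
  congr 1
  refine tsum_congr fun n => ?_
  symm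
  refine Fintype.sum_of_injective (fun (es : Fin (n + 1) → E) i => some (es i)) ?_ _ _ ?_ ?_
  · intro f g hfg
    funext i
    exact Option.some_injective _ (congrFun hfg i)
  · intro es hes
    cases hl : es (Fin.last n) with
    | none => simp
    | some e =>
      have hex : ∃ i, es i = none := by
        by_contra hne
        push Not at hne
        choose f hf using fun i => Option.ne_none_iff_exists.mp (hne i)
        exact hes ⟨f, funext hf⟩
      obtain ⟨i, hi⟩ := hex
      have hmem : (none : Option E) ∈ List.ofFn (fun j : Fin n => es j.castSucc) := by
        induction i using Fin.lastCases with
        | last => rw [hl] at hi; cases hi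
        | cast j => exact (List.mem_ofFn' _ _).mpr ⟨j, hi⟩
      rw [List.ofFn_succ_last, ds_extend_snoc, ds_env_snoc, hl]
      have hm2 : (none : Option E) ∈ (extendHist π (embed h)
          (List.ofFn (fun j : Fin n => es j.castSucc))).map Prod.snd := by
        rw [ds_extend_snd]
        exact List.mem_append_right _ hmem
      simp only [deathCond, if_pos hm2, mul_zero, zero_div]
  · intro es
    have h1 : List.ofFn (fun i => some (es i)) = (List.ofFn es).map some := by
      simp [List.map_ofFn, Function.comp_def]
    simp only [h1, ds_extend_embed, ds_env_embed μ hμ, Option.elim_some]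
end

section
/- Optimal behaviour is the same in μ and its equivalent death-state environment: Let μ be an environment semimeasure over percept set E and μ' its equivalent death-state environment over E_d = E ∪ {e^d} with death-reward r(e^d) = 0. Then for every history h over A × E (containing no occurrence of e^d) with μ(h) > 0 and every action a ∈ A, V*_{μ'}(h, a) = V*_μ(h, a); consequently an action a maximizes the map a ↦ V*_{μ'}(h, a) over A if and only if it maximizes a ↦ V*_μ(h, a). -/
open scoped BigOperators

theorem extendHist_append {A E : Type} (π : Hist A E → A) (l : List E) (e : E) :
    ∀ h : Hist A E, extendHist π h (l ++ [e]) =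
      extendHist π h l ++ [(π (extendHist π h l), e)] := by
  induction l with
  | nil => intro h; simp [extendHist]
  | cons x l ih => intro h; simp [extendHist, ih]

theorem extendHist_snd {A E : Type} (π : Hist A E → A) (l : List E) :
    ∀ h : Hist A E, (extendHist π h l).map Prod.snd = h.map Prod.snd ++ l := by
  induction l with
  | nil => intro h; simp [extendHist]
  | cons x l ih => intro h; simp [extendHist, ih]

theorem embed_injective {A E : Type} : Function.Injective (embed : Hist A E → _) := by
  apply List.map_injective_iff.2
  rintro ⟨a, e⟩ ⟨b, f⟩ hh
  simpa using hh

theorem strip_embed {A E : Type} (h : Hist A E) : strip (embed h) = h := by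
  induction h with
  | nil => rfl
  | cons p h ih =>
    simp only [strip, embed] at ih ⊢
    simp [ih]

theorem embed_no_death {A E : Type} (h : Hist A E) :
    (Option.none : Option E) ∉ (embed h).map Prod.snd := by
  simp [embed]

theorem extendHist_embed {A E : Type} (π' : Hist A (Option E) → A) (π : Hist A E → A)
    (hπ : ∀ h, π' (embed h) = π h) (l : List E) :
    ∀ h : Hist A E, extendHist π' (embed h) (l.map some) = embed (extendHist π h l) := by
  induction l with
  | nil => intro h; simp [extendHist]
  | cons x l ih =>
    intro h
    have := ih (h ++ [(π h, x)])
    simp only [extendHist, List.map_cons, hπ]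
    rw [← this]
    simp [embed]

theorem deathEnv_append {A E : Type} [Fintype E] [DecidableEq A] [DecidableEq E]
    (μ : Hist A E → ℝ) (h : Hist A (Option E)) (a : A) (e : Option E) :
    deathEnv μ (h ++ [(a, e)]) = deathEnv μ h * deathCond μ h a e := by
  simp [deathEnv, deathEnvAux]

theorem deathEnv_embed {A E : Type} [Fintype E] [DecidableEq A] [DecidableEq E]
    (μ : Hist A E → ℝ) (hμ : IsEnvSemimeasure μ) (h : Hist A E) :
    deathEnv μ (embed h) = μ h := by
  obtain ⟨h01, h1, hs⟩ := hμ
  induction h using List.reverseRecOn with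
  | nil => simp [embed, deathEnv, deathEnvAux, h1]
  | append_singleton h p ih =>
    obtain ⟨a, e⟩ := p
    have he : embed (h ++ [(a, e)]) = embed h ++ [(a, some e)] := by simp [embed]
    rw [he, deathEnv_append, ih]
    simp only [deathCond, if_neg (embed_no_death h), strip_embed, condProb]
    by_cases h0 : μ h = 0
    · have h2 := hs h a
      have h3 : μ (h ++ [(a, e)]) ≤ ∑ e : E, μ (h ++ [(a, e)]) :=
        Finset.single_le_sum (f := fun e => μ (h ++ [(a, e)]))
          (fun i _ => (h01 _).1) (Finset.mem_univ e)
      have h4 := (h01 (h ++ [(a, e)])).1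
      rw [h0, zero_mul]
      linarith
    · field_simp

theorem value_embed {A E : Type} [Fintype E] [DecidableEq A] [DecidableEq E]
    (γ : ℕ → ℝ) (r : E → ℝ) (μ : Hist A E → ℝ) (hμ : IsEnvSemimeasure μ)
    (π' : Hist A (Option E) → A) (π : Hist A E → A)
    (hπ : ∀ h, π' (embed h) = π h) (h : Hist A E) :
    value γ (fun e : Option E => e.elim 0 r) (deathEnv μ) π' (embed h) = value γ r μ π h := by
  have hl : (embed h).length = h.length := by simp [embed]
  unfold value
  rw [hl, deathEnv_embed μ hμ]
  congr 1
  refine tsum_congr fun n => ?_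
  symm
  refine Finset.sum_of_injOn (fun es i => some (es i)) ?_ (by simp) ?_ ?_
  · intro x _ y _ hxy
    funext i
    exact Option.some_injective _ (congrFun hxy i)
  · intro es _ hes
    cases hlast : es (Fin.last n) with
    | none => simp
    | some e =>
      have hex : ∃ i, es i = none := by
        by_contra hne
        push Not at hne
        apply hes
        choose f hf using fun i => Option.ne_none_iff_exists'.1 (hne i)
        exact ⟨f, by simp, funext fun i => (hf i).symm⟩
      obtain ⟨i, hi⟩ := hex
      have hmem : none ∈ List.ofFn (fun i : Fin n => es i.castSucc) := by
        rw [List.mem_ofFn]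
        induction i using Fin.lastCases with
        | last => simp [hlast] at hi
        | cast j => exact ⟨j, hi⟩
      have hz : deathEnv μ (extendHist π' (embed h) (List.ofFn es)) = 0 := by
        rw [List.ofFn_succ', List.concat_eq_append, extendHist_append, deathEnv_append, hlast]
        simp only [deathCond]
        rw [if_pos, mul_zero]
        rw [extendHist_snd]
        exact List.mem_append_right _ hmem
      rw [hz, mul_zero, zero_div]
  · intro es _
    have : List.ofFn (fun i => some (es i)) = (List.ofFn es).map some := by
      rw [List.map_ofFn]; rfl
    simp only [this, extendHist_embed π' π hπ, deathEnv_embed μ hμ, Option.elim_some]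

theorem vStar_embed {A E : Type} [Fintype E] [DecidableEq A] [DecidableEq E]
    (γ : ℕ → ℝ) (r : E → ℝ) (μ : Hist A E → ℝ) (hμ : IsEnvSemimeasure μ)
    (h : Hist A E) (a : A) :
    vStar γ (fun e : Option E => e.elim 0 r) (deathEnv μ) (embed h) a = vStar γ r μ h a := by
  unfold vStar
  have hsurj : Function.Surjective
      (fun (π' : Hist A (Option E) → A) (h : Hist A E) => π' (embed h)) := by
    intro π
    exact ⟨fun h => π (strip h), funext fun h => by simp [strip_embed]⟩
  rw [← hsurj.iSup_comp]
  congr 1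
  funext π'
  unfold valueAct
  apply value_embed γ r μ hμ
  intro h'
  simp [embed_injective.eq_iff]

/-- Optimal behaviour is the same in μ and its equivalent
death-state environment: V*_{μ'}(h, a) = V*_μ(h, a) for every death-free
history h with μ(h) > 0 and every action a; consequently a maximizes
a ↦ V*_{μ'}(h, a) iff it maximizes a ↦ V*_μ(h, a). -/
theorem deathstate_optimal_value_equivalence
    {A E : Type} [Fintype A] [Nonempty A] [Fintype E] [Nonempty E]
    [DecidableEq A] [DecidableEq E]
    (γ : ℕ → ℝ) (hγpos : ∀ t, 0 < γ t) (hγsum : Summable γ)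
    (r : E → ℝ)
    (μ : Hist A E → ℝ) (hμ : IsEnvSemimeasure μ)
    (h : Hist A E) (hpos : 0 < μ h) :
    (∀ a : A,
      vStar γ (fun e : Option E => e.elim 0 r) (deathEnv μ) (embed h) a
        = vStar γ r μ h a) ∧
    (∀ a : A,
      (∀ b : A,
        vStar γ (fun e : Option E => e.elim 0 r) (deathEnv μ) (embed h) b
          ≤ vStar γ (fun e : Option E => e.elim 0 r) (deathEnv μ) (embed h) a)
        ↔ (∀ b : A, vStar γ r μ h b ≤ vStar γ r μ h a)) := by
  have key := vStar_embed γ r μ hμ h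
  exact ⟨key, fun a => by simp only [key]⟩
end

section
/- Self-preserving AIμ: Let μ be an environment semimeasure and suppose r(e) ≥ 0 for all e ∈ E. Let h be a history with μ(h) > 0, let a' ∈ A satisfy L_μ(h, a') = 1, and suppose there exists ā ∈ A with V*_μ(h, ā) ≠ 0. Then V*_μ(h, a') < V*_μ(h, ā); in particular, no action a maximizing the map a ↦ V*_μ(h, a) over A satisfies L_μ(h, a) = 1, so an optimal agent does not take the action a'. -/
open scoped BigOperators

lemma mu_step_le {A E : Type} [Fintype E] (μ : Hist A E → ℝ) (hμ : IsEnvSemimeasure μ)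
    (h : Hist A E) (a : A) (e : E) : μ (h ++ [(a, e)]) ≤ μ h :=
  (Finset.single_le_sum (f := fun e => μ (h ++ [(a, e)])) (fun e _ => (hμ.1 _).1)
    (Finset.mem_univ e)).trans (hμ.2.2 h a)

lemma mu_extend_le {A E : Type} [Fintype E] (μ : Hist A E → ℝ) (hμ : IsEnvSemimeasure μ)
    (π : Hist A E → A) (es : List E) : ∀ h : Hist A E, μ (extendHist π h es) ≤ μ h := by
  induction es with
  | nil => intro h; exact le_refl _
  | cons e es ih => intro h; exact (ih _).trans (mu_step_le μ hμ h _ e)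

lemma vStar_nonneg {A E : Type} [Fintype E] [DecidableEq A] [DecidableEq E]
    (γ : ℕ → ℝ) (hγpos : ∀ t, 0 < γ t) (r : E → ℝ) (hr : ∀ e : E, 0 ≤ r e)
    (μ : Hist A E → ℝ) (hμ : IsEnvSemimeasure μ) (h : Hist A E) (a : A) :
    0 ≤ vStar γ r μ h a := by
  refine Real.iSup_nonneg fun π => ?_
  refine mul_nonneg (inv_nonneg.2 (tsum_nonneg fun k => (hγpos _).le)) (tsum_nonneg fun n => ?_)
  refine Finset.sum_nonneg fun es _ => ?_
  exact div_nonneg (mul_nonneg (mul_nonneg (hγpos _).le (hr _)) (hμ.1 _).1) (hμ.1 _).1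

lemma vStar_eq_zero {A E : Type} [Fintype E] [DecidableEq A] [DecidableEq E]
    (γ : ℕ → ℝ) (r : E → ℝ)
    (μ : Hist A E → ℝ) (hμ : IsEnvSemimeasure μ) (h : Hist A E) (hpos : 0 < μ h) (a : A)
    (hloss : measLoss μ h a = 1) : vStar γ r μ h a = 0 := by
  have hsum : ∑ e : E, condProb μ h a e = 0 := by
    unfold measLoss at hloss; linarith
  have hz : ∀ e, μ (h ++ [(a, e)]) = 0 := by
    intro e
    have h1 := (Finset.sum_eq_zero_iff_of_nonneg
      (fun e _ => div_nonneg (hμ.1 _).1 (hμ.1 _).1)).1 hsum e (Finset.mem_univ e)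
    exact (div_eq_zero_iff.1 h1).resolve_right hpos.ne'
  have hv : ∀ π, valueAct γ r μ π h a = 0 := by
    intro π
    have hx : ∀ (n : ℕ) (es : Fin (n + 1) → E),
        μ (extendHist (fun h' => if h' = h then a else π h') h (List.ofFn es)) = 0 := by
      intro n es
      refine le_antisymm ?_ (hμ.1 _).1
      rw [List.ofFn_succ]
      refine (mu_extend_le μ hμ (fun h' => if h' = h then a else π h') _ (h ++ [(_, _)])).trans ?_
      simp only [if_true]
      exact (hz _).le
    simp only [valueAct, value, hx, mul_zero, zero_div, Finset.sum_const_zero, tsum_zero]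
  simp [vStar, hv]

/-- Self-preserving AIμ: with non-negative rewards, if action a'
has full measure loss and some action ā has nonzero optimal value, then
V*_μ(h, a') < V*_μ(h, ā); in particular no optimal action has full measure
loss, so an optimal agent does not take a'. -/
theorem self_preserving_AImu
    {A E : Type} [Fintype A] [Nonempty A] [Fintype E] [Nonempty E]
    [DecidableEq A] [DecidableEq E]
    (γ : ℕ → ℝ) (hγpos : ∀ t, 0 < γ t) (hγsum : Summable γ)
    (r : E → ℝ) (hr : ∀ e : E, 0 ≤ r e)
    (μ : Hist A E → ℝ) (hμ : IsEnvSemimeasure μ)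
    (h : Hist A E) (hpos : 0 < μ h)
    (a' : A) (hloss : measLoss μ h a' = 1)
    (abar : A) (habar : vStar γ r μ h abar ≠ 0) :
    vStar γ r μ h a' < vStar γ r μ h abar ∧
      ∀ a : A, (∀ b : A, vStar γ r μ h b ≤ vStar γ r μ h a) → measLoss μ h a ≠ 1 := by
  have hp : 0 < vStar γ r μ h abar :=
    lt_of_le_of_ne (vStar_nonneg γ hγpos r hr μ hμ h abar) habar.symm
  refine ⟨by rw [vStar_eq_zero γ r μ hμ h hpos a' hloss]; exact hp, fun a ha hl => ?_⟩
  have h1 := ha abar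
  rw [vStar_eq_zero γ r μ hμ h hpos a hl] at h1
  exact absurd hp (not_lt.2 h1)
end

section
/- Suicidal AIμ: Let μ be an environment semimeasure and suppose r(e) < 0 for all e ∈ E. Let h be a history with μ(h) > 0 and suppose the suicide set A^suicide(h) := {a ∈ A : L_μ(h, a) = 1} is nonempty. Then V*_μ(h, a') = 0 for every a' ∈ A^suicide(h) and V*_μ(h, ā) < 0 for every ā ∉ A^suicide(h); consequently every action maximizing the map a ↦ V*_μ(h, a) over A belongs to A^suicide(h), so an optimal agent takes a suicidal action. -/
open scoped BigOperators

theorem aux_le {A E : Type} [Fintype E] (ν : Hist A E → ℝ) (hν : IsEnvSemimeasure ν)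
    (π : Hist A E → A) (es : List E) : ∀ h : Hist A E, ν (extendHist π h es) ≤ ν h := by
  induction es with
  | nil => intro h; exact le_rfl
  | cons e es ih =>
    intro h
    refine (ih _).trans (le_trans ?_ (hν.2.2 h (π h)))
    exact Finset.single_le_sum (f := fun e => ν (h ++ [(π h, e)]))
      (fun i _ => (hν.1 _).1) (Finset.mem_univ e)

theorem aux_sum {A E : Type} [Fintype E] (ν : Hist A E → ℝ) (hν : IsEnvSemimeasure ν)
    (π : Hist A E → A) (n : ℕ) : ∀ h : Hist A E,
    ∑ es : Fin n → E, ν (extendHist π h (List.ofFn es)) ≤ ν h := by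
  induction n with
  | zero => intro h; simp [extendHist]
  | succ n ih =>
    intro h
    rw [← (Fin.consEquiv (fun _ : Fin (n + 1) => E)).sum_comp, Fintype.sum_prod_type]
    refine le_trans (Finset.sum_le_sum fun e _ => ?_) (hν.2.2 h (π h))
    simpa [Fin.consEquiv, List.ofFn_succ, extendHist] using ih (h ++ [(π h, e)])

theorem aux_summable {A E : Type} [Fintype E] [Nonempty E]
    (γ : ℕ → ℝ) (hγpos : ∀ t, 0 < γ t) (hγsum : Summable γ) (r : E → ℝ)
    (ν : Hist A E → ℝ) (hν : IsEnvSemimeasure ν)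
    (π : Hist A E → A) (h : Hist A E) (hpos : 0 < ν h) :
    Summable fun n : ℕ => ∑ es : Fin (n + 1) → E,
      γ (h.length + n) * r (es (Fin.last n)) * ν (extendHist π h (List.ofFn es)) / ν h := by
  have hs : Summable fun n : ℕ => γ (h.length + n) * ∑ e, |r e| := by
    apply Summable.mul_right
    exact hγsum.comp_injective (add_right_injective h.length)
  refine Summable.of_norm_bounded hs fun n => ?_
  rw [Real.norm_eq_abs]
  refine (Finset.abs_sum_le_sum_abs _ _).trans ?_
  have hR : 0 ≤ ∑ e, |r e| := Finset.sum_nonneg fun _ _ => abs_nonneg _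
  calc _ ≤ ∑ es : Fin (n + 1) → E, γ (h.length + n) * (∑ e, |r e|) / ν h
            * ν (extendHist π h (List.ofFn es)) := by
        refine Finset.sum_le_sum fun es _ => ?_
        rw [abs_div, abs_mul, abs_mul, abs_of_pos hpos, abs_of_pos (hγpos _),
          abs_of_nonneg (hν.1 _).1, div_mul_eq_mul_div]
        have h1 : |r (es (Fin.last n))| ≤ ∑ e, |r e| :=
          Finset.single_le_sum (f := fun e => |r e|) (fun _ _ => abs_nonneg _) (Finset.mem_univ _)
        have h2 := (hν.1 (extendHist π h (List.ofFn es))).1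
        have h3 := (hγpos (h.length + n)).le
        gcongr
    _ ≤ _ := by
        rw [← Finset.mul_sum]
        have h3 := (hγpos (h.length + n)).le
        refine (mul_le_mul_of_nonneg_left (aux_sum ν hν π (n + 1) h) (by positivity)).trans ?_
        rw [div_mul_cancel₀ _ hpos.ne']

theorem aux_loss {A E : Type} [Fintype E] (ν : Hist A E → ℝ) (hν : IsEnvSemimeasure ν)
    (h : Hist A E) (hpos : 0 < ν h) (a : A) :
    measLoss ν h a = 1 ↔ ∀ e, ν (h ++ [(a, e)]) = 0 := by
  unfold measLoss condProb
  rw [sub_eq_self, Finset.sum_eq_zero_iff_of_nonneg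
    (fun e _ => div_nonneg (hν.1 _).1 hpos.le)]
  simp [hpos.ne']

theorem aux_first {A E : Type} [Fintype E] [Nonempty E]
    (γ : ℕ → ℝ) (hγpos : ∀ t, 0 < γ t) (hγsum : Summable γ) (r : E → ℝ) (hr : ∀ e, r e < 0)
    (ν : Hist A E → ℝ) (hν : IsEnvSemimeasure ν)
    (π : Hist A E → A) (h : Hist A E) (hpos : 0 < ν h) :
    value γ r ν π h ≤ (Γtail γ h.length)⁻¹ *
      ∑ e : E, γ h.length * r e * ν (h ++ [(π h, e)]) / ν h := by
  unfold value
  have hΓ : 0 ≤ Γtail γ h.length := tsum_nonneg fun k => (hγpos _).le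
  refine mul_le_mul_of_nonneg_left ?_ (inv_nonneg.2 hΓ)
  have hs := aux_summable γ hγpos hγsum r ν hν π h hpos
  rw [hs.tsum_eq_zero_add]
  have h1 : ∑' n : ℕ, ∑ es : Fin (n + 1 + 1) → E,
      γ (h.length + (n + 1)) * r (es (Fin.last (n + 1))) *
        ν (extendHist π h (List.ofFn es)) / ν h ≤ 0 := by
    refine tsum_nonpos fun n => Finset.sum_nonpos fun es _ => ?_
    refine div_nonpos_of_nonpos_of_nonneg ?_ hpos.le
    exact mul_nonpos_of_nonpos_of_nonneg
      (mul_nonpos_of_nonneg_of_nonpos (hγpos _).le (hr _).le) (hν.1 _).1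
  have h2 : ∑ es : Fin (0 + 1) → E, γ (h.length + 0) * r (es (Fin.last 0)) *
        ν (extendHist π h (List.ofFn es)) / ν h
      = ∑ e : E, γ h.length * r e * ν (h ++ [(π h, e)]) / ν h := by
    rw [← (Equiv.funUnique (Fin 1) E).symm.sum_comp]
    simp [extendHist, Equiv.funUnique]
  linarith

/-- Suicidal AIμ: with negative rewards, if the suicide set
{a : L_μ(h,a) = 1} is nonempty, then every suicidal action has optimal value 0,
every non-suicidal action has negative optimal value, and consequently every
action maximizing a ↦ V*_μ(h, a) is suicidal. -/
theorem suicidal_AImu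
    {A E : Type} [Fintype A] [Nonempty A] [Fintype E] [Nonempty E]
    [DecidableEq A] [DecidableEq E]
    (γ : ℕ → ℝ) (hγpos : ∀ t, 0 < γ t) (hγsum : Summable γ)
    (r : E → ℝ) (hr : ∀ e : E, r e < 0)
    (μ : Hist A E → ℝ) (hμ : IsEnvSemimeasure μ)
    (h : Hist A E) (hpos : 0 < μ h)
    (hne : ∃ a : A, measLoss μ h a = 1) :
    (∀ a' : A, measLoss μ h a' = 1 → vStar γ r μ h a' = 0) ∧
    (∀ abar : A, measLoss μ h abar ≠ 1 → vStar γ r μ h abar < 0) ∧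
    (∀ a : A, (∀ b : A, vStar γ r μ h b ≤ vStar γ r μ h a) → measLoss μ h a = 1) := by
  have hΓ : 0 < Γtail γ h.length := by
    have hs : Summable fun k : ℕ => γ (h.length + k) :=
      hγsum.comp_injective (add_right_injective h.length)
    exact hs.tsum_pos (fun k => (hγpos _).le) 0 (hγpos _)
  have P1 : ∀ a' : A, measLoss μ h a' = 1 → vStar γ r μ h a' = 0 := by
    intro a ha
    rw [aux_loss μ hμ h hpos] at ha
    have hz : ∀ π : Hist A E → A, valueAct γ r μ π h a = 0 := by
      intro π
      unfold valueAct value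
      have : ∀ n : ℕ, ∑ es : Fin (n + 1) → E, γ (h.length + n) * r (es (Fin.last n)) *
          μ (extendHist (fun h' => if h' = h then a else π h') h (List.ofFn es)) / μ h = 0 := by
        intro n
        refine Finset.sum_eq_zero fun es _ => ?_
        have h0 : μ (extendHist (fun h' => if h' = h then a else π h') h (List.ofFn es)) = 0 := by
          refine le_antisymm ?_ (hμ.1 _).1
          rw [List.ofFn_succ, extendHist]
          refine (aux_le μ hμ _ _ _).trans ?_
          simp [ha]
        rw [h0, mul_zero, zero_div]
      rw [tsum_congr this, tsum_zero, mul_zero]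
    unfold vStar
    simp [hz]
  have P2 : ∀ abar : A, measLoss μ h abar ≠ 1 → vStar γ r μ h abar < 0 := by
    intro a ha
    rw [Ne, aux_loss μ hμ h hpos] at ha
    push Not at ha
    obtain ⟨e0, he0⟩ := ha
    have hb : vStar γ r μ h a ≤ (Γtail γ h.length)⁻¹ *
        ∑ e : E, γ h.length * r e * μ (h ++ [(a, e)]) / μ h := by
      unfold vStar valueAct
      refine ciSup_le fun π => ?_
      simpa using aux_first γ hγpos hγsum r hr μ hμ (fun h' => if h' = h then a else π h') h hpos
    refine hb.trans_lt (mul_neg_of_pos_of_neg (inv_pos.2 hΓ) ?_)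
    refine Finset.sum_neg' (fun e _ => ?_) ⟨e0, Finset.mem_univ _, ?_⟩
    · exact div_nonpos_of_nonpos_of_nonneg (mul_nonpos_of_nonpos_of_nonneg
        (mul_nonpos_of_nonneg_of_nonpos (hγpos _).le (hr _).le) (hμ.1 _).1) hpos.le
    · exact div_neg_of_neg_of_pos (mul_neg_of_neg_of_pos
        (mul_neg_of_pos_of_neg (hγpos _) (hr _)) (lt_of_le_of_ne (hμ.1 _).1 he0.symm)) hpos
  refine ⟨P1, P2, fun a hmax => ?_⟩
  by_contra hc
  obtain ⟨b, hb⟩ := hne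
  have := hmax b
  rw [P1 b hb] at this
  exact absurd (P2 a hc) (not_lt.2 this)
end

section
/- Ratio of posterior belief in μ to μ_norm is monotonically decreasing: Let M be a countable class of environment semimeasures with Bayesian mixture ξ and posterior weights w_ν(h), and let μ ∈ M be an environment semimeasure whose Solomonoff normalization μ_norm is also in M. Let (a_k, e_k)_{k≥1} be an infinite action–percept sequence with prefixes h_t := [(a_1,e_1),…,(a_t,e_t)], and assume μ(h_t) > 0 for all t (hence μ_norm(h_t) > 0 and ξ(h_t) > 0). Then for every t ≥ 0, w_μ(h_{t+1}) / w_{μ_norm}(h_{t+1}) ≤ w_μ(h_t) / w_{μ_norm}(h_t). -/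
open scoped BigOperators

noncomputable def solNormAux {A E : Type} [Fintype E] (ν : Hist A E → ℝ) :
    List (A × E) → ℝ
  | [] => 1
  | (a, e) :: rest =>
      solNormAux ν rest *
        (ν (rest.reverse ++ [(a, e)]) / ∑ z : E, ν (rest.reverse ++ [(a, z)]))

/-- The Solomonoff normalization ν_norm of a semimeasure ν:
ν_norm([]) = 1 and ν_norm(h ++ [(a,e)]) = ν_norm(h) · ν(h ++ [(a,e)]) / Σ_z ν(h ++ [(a,z)]). -/
noncomputable def solNorm {A E : Type} [Fintype E] (ν : Hist A E → ℝ) (h : Hist A E) : ℝ :=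
  solNormAux ν h.reverse
/-- The Bayesian mixture ξ(h) = Σ_ν w_ν ν(h) over a countable class of environments. -/
noncomputable def mix {A E M : Type} (w : M → ℝ) (envs : M → Hist A E → ℝ)
    (h : Hist A E) : ℝ :=
  ∑' m : M, w m * envs m h

/-- The posterior weight w_ν(h) = w_ν · ν(h) / ξ(h). -/
noncomputable def postWeight {A E M : Type} (w : M → ℝ) (envs : M → Hist A E → ℝ)
    (m : M) (h : Hist A E) : ℝ :=
  w m * envs m h / mix w envs h
/-- The length-t prefix history h_t = [(a_1,e_1),…,(a_t,e_t)] of an infinite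
action–percept sequence. -/
def histOf {A E : Type} (as : ℕ → A) (es : ℕ → E) (t : ℕ) : Hist A E :=
  (List.range t).map (fun k => (as k, es k))

/-- Ratio of posterior belief in μ to μ_norm is monotonically
decreasing: for a countable class M containing both μ and its Solomonoff
normalization μ_norm, along any sequence on which μ(h_t) > 0 the ratio of
posterior weights w_μ(h_t)/w_{μ_norm}(h_t) is monotonically decreasing. -/
theorem posterior_ratio_monotone_decreasing
    {A E : Type} [Fintype A] [Nonempty A] [Fintype E] [Nonempty E]
    (M : Type) [Countable M]
    (envs : M → Hist A E → ℝ) (hM : ∀ m : M, IsEnvSemimeasure (envs m))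
    (w : M → ℝ) (hw : ∀ m : M, 0 < w m) (hwsum : Summable w)
    (hw1 : (∑' m : M, w m) ≤ 1)
    (m mn : M) (hmn : envs mn = solNorm (envs m))
    (as : ℕ → A) (es : ℕ → E)
    (hpos : ∀ t : ℕ, 0 < envs m (histOf as es t)) :
    ∀ t : ℕ,
      postWeight w envs m (histOf as es (t + 1))
          / postWeight w envs mn (histOf as es (t + 1))
        ≤ postWeight w envs m (histOf as es t)
          / postWeight w envs mn (histOf as es t) := by
  have hsucc : ∀ t, histOf as es (t + 1) = histOf as es t ++ [(as t, es t)] := by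
    intro t
    simp [histOf, List.range_succ]
  have hnorm : ∀ t, solNorm (envs m) (histOf as es (t + 1)) =
      solNorm (envs m) (histOf as es t) *
        (envs m (histOf as es (t + 1)) /
          ∑ z : E, envs m (histOf as es t ++ [(as t, z)])) := by
    intro t
    rw [hsucc]
    simp [solNorm, solNormAux]
  have hS : ∀ t, 0 < ∑ z : E, envs m (histOf as es t ++ [(as t, z)]) := by
    intro t
    refine Finset.sum_pos' (fun z _ => ((hM m).1 _).1) ⟨es t, Finset.mem_univ _, ?_⟩
    rw [← hsucc]
    exact hpos _
  have hnpos : ∀ t, 0 < solNorm (envs m) (histOf as es t) := by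
    intro t
    induction t with
    | zero => simp [histOf, solNorm, solNormAux]
    | succ t ih =>
      rw [hnorm]
      exact mul_pos ih (div_pos (hpos _) (hS t))
  have hmix : ∀ t, 0 < mix w envs (histOf as es t) := by
    intro t
    have hnn : ∀ i, 0 ≤ w i * envs i (histOf as es t) :=
      fun i => mul_nonneg (hw i).le ((hM i).1 _).1
    have hsm : Summable (fun i => w i * envs i (histOf as es t)) :=
      Summable.of_nonneg_of_le hnn
        (fun i => mul_le_of_le_one_right (hw i).le ((hM i).1 _).2) hwsum
    exact hsm.tsum_pos hnn m (mul_pos (hw m) (hpos t))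
  have hratio : ∀ t, postWeight w envs m (histOf as es t)
      / postWeight w envs mn (histOf as es t) =
      (w m * envs m (histOf as es t)) / (w mn * solNorm (envs m) (histOf as es t)) := by
    intro t
    unfold postWeight
    rw [div_div_div_cancel_right₀ (hmix t).ne', hmn]
  intro t
  rw [hratio, hratio, hnorm]
  have h1 := hpos (t + 1)
  have h2 := hS t
  have h3 := hnpos t
  have h4 := hw m
  have h5 := hw mn
  have h6 := (hM m).2.2 (histOf as es t) (as t)
  have key : w m * envs m (histOf as es (t + 1)) /
      (w mn * (solNorm (envs m) (histOf as es t) *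
        (envs m (histOf as es (t + 1)) /
          ∑ z : E, envs m (histOf as es t ++ [(as t, z)])))) =
      w m * (∑ z : E, envs m (histOf as es t ++ [(as t, z)])) /
        (w mn * solNorm (envs m) (histOf as es t)) := by
    field_simp
  rw [key]
  gcongr
end

section
/- Asymptotic ξ-probability of death vanishes under summable squared deviation from the normalized environment: Let μ and ξ be environment semimeasures and let (a_k, e_k)_{k≥1} be an infinite action–percept sequence with prefixes h_t := [(a_1,e_1),…,(a_t,e_t)]. Assume μ(h_t) > 0 and ξ(h_t) > 0 for all t ≥ 0, and write μ_norm(e | h, a) := μ(h ++ [(a,e)]) / Σ_{z∈E} μ(h ++ [(a,z)]) (the denominators are positive since μ(h_{t+1}) > 0). If Σ_{t=0}^∞ Σ_{e∈E} (μ_norm(e | h_t, a_{t+1}) − ξ(e | h_t, a_{t+1}))² < ∞, then lim_{t→∞} L_ξ(h_t, a_{t+1}) = 0. -/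
open scoped BigOperators

/-- The one-step conditional of the normalized environment:
ν_norm(e | h, a) = ν(h ++ [(a,e)]) / Σ_z ν(h ++ [(a,z)]). -/
noncomputable def normCond {A E : Type} [Fintype E] (ν : Hist A E → ℝ)
    (h : Hist A E) (a : A) (e : E) : ℝ :=
  ν (h ++ [(a, e)]) / ∑ z : E, ν (h ++ [(a, z)])
/-- Asymptotic ξ-probability of death vanishes under summable
squared deviation from the normalized environment: if the total squared
deviation between μ_norm and ξ along the sequence is finite, then the
instantaneous ξ-measure loss tends to 0. -/
theorem xi_loss_vanishes_of_summable_sq_dev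
    {A E : Type} [Fintype A] [Nonempty A] [Fintype E] [Nonempty E]
    (μ ξ : Hist A E → ℝ) (hμ : IsEnvSemimeasure μ) (hξ : IsEnvSemimeasure ξ)
    (as : ℕ → A) (es : ℕ → E)
    (hμpos : ∀ t : ℕ, 0 < μ (histOf as es t))
    (hξpos : ∀ t : ℕ, 0 < ξ (histOf as es t))
    (hsum : Summable (fun t : ℕ =>
      ∑ e : E, (normCond μ (histOf as es t) (as t) e
          - condProb ξ (histOf as es t) (as t) e) ^ 2)) :
    Filter.Tendsto (fun t : ℕ => measLoss ξ (histOf as es t) (as t))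
      Filter.atTop (nhds 0) := by
  have h0 := hsum.tendsto_atTop_zero
  have hterm : ∀ e : E, Filter.Tendsto (fun t : ℕ => normCond μ (histOf as es t) (as t) e
      - condProb ξ (histOf as es t) (as t) e) Filter.atTop (nhds 0) := by
    intro e
    have h1 : Filter.Tendsto (fun t : ℕ => √(∑ e : E, (normCond μ (histOf as es t) (as t) e
          - condProb ξ (histOf as es t) (as t) e) ^ 2)) Filter.atTop (nhds 0) := by
      have h2 := (Real.continuous_sqrt.tendsto 0).comp h0
      rw [Real.sqrt_zero] at h2
      exact h2
    refine squeeze_zero_norm (fun t => ?_) h1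
    rw [Real.norm_eq_abs]
    apply Real.abs_le_sqrt
    exact Finset.single_le_sum (f := fun e : E => (normCond μ (histOf as es t) (as t) e
          - condProb ξ (histOf as es t) (as t) e) ^ 2)
      (fun i _ => sq_nonneg _) (Finset.mem_univ e)
  have hs := tendsto_finsetSum (Finset.univ : Finset E) (fun e _ => hterm e)
  rw [Finset.sum_const_zero] at hs
  refine hs.congr (fun t => ?_)
  have hsucc : histOf as es (t + 1) = histOf as es t ++ [(as t, es t)] := by
    simp [histOf, List.range_succ]
  have hpos : 0 < ∑ z : E, μ (histOf as es t ++ [(as t, z)]) := by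
    refine Finset.sum_pos' (fun z _ => (hμ.1 _).1) ⟨es t, Finset.mem_univ _, ?_⟩
    rw [← hsucc]
    exact hμpos (t + 1)
  rw [Finset.sum_sub_distrib]
  unfold measLoss normCond
  rw [← Finset.sum_div, div_self hpos.ne']
end

section
/- Any prescribed sequence of death-probabilities is realized by some environment semimeasure: Let ℓ be any function assigning to each pair (h, a) of a history h and an action a a real number ℓ(h, a) ∈ [0,1]. Then there exists an environment semimeasure ν such that for every history h with ν(h) > 0 and every action a ∈ A, the instantaneous measure loss satisfies L_ν(h, a) = ℓ(h, a). -/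
open scoped BigOperators

/-- Weight of a reversed history: each step multiplies by `(1 - ℓ) / |E|`. -/
noncomputable def revWeight {A E : Type} [Fintype E] (ℓ : Hist A E → A → ℝ) :
    List (A × E) → ℝ
  | [] => 1
  | p :: t => revWeight ℓ t * ((1 - ℓ t.reverse p.1) / (Fintype.card E : ℝ))

/-- Any prescribed sequence of death-probabilities is realized by
some environment semimeasure: for any ℓ assigning each (h, a) a value in [0,1],
there is an environment semimeasure ν with L_ν(h, a) = ℓ(h, a) whenever ν(h) > 0. -/
theorem exists_semimeasure_with_prescribed_loss
    {A E : Type} [Fintype A] [Nonempty A] [Fintype E] [Nonempty E]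
    (ℓ : Hist A E → A → ℝ) (hℓ : ∀ (h : Hist A E) (a : A), ℓ h a ∈ Set.Icc (0 : ℝ) 1) :
    ∃ ν : Hist A E → ℝ, IsEnvSemimeasure ν ∧
      ∀ (h : Hist A E) (a : A), 0 < ν h → measLoss ν h a = ℓ h a := by
  have hc : (1 : ℝ) ≤ (Fintype.card E : ℝ) := by
    exact_mod_cast Fintype.card_pos (α := E)
  have hc0 : (Fintype.card E : ℝ) ≠ 0 := by positivity
  have hb : ∀ t : List (A × E), 0 ≤ revWeight ℓ t ∧ revWeight ℓ t ≤ 1 := by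
    intro t
    induction t with
    | nil => simp [revWeight]
    | cons p t ih =>
      obtain ⟨h0, h1⟩ := hℓ t.reverse p.1
      have g0 : 0 ≤ (1 - ℓ t.reverse p.1) / (Fintype.card E : ℝ) :=
        div_nonneg (by linarith) (by linarith)
      have g1 : (1 - ℓ t.reverse p.1) / (Fintype.card E : ℝ) ≤ 1 :=
        div_le_one_of_le₀ (by linarith) (by linarith)
      exact ⟨mul_nonneg ih.1 g0, mul_le_one₀ ih.2 g0 g1⟩
  have hstep : ∀ (h : Hist A E) (a : A) (e : E), revWeight ℓ (h ++ [(a, e)]).reverse =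
      revWeight ℓ h.reverse * ((1 - ℓ h a) / (Fintype.card E : ℝ)) := by
    intro h a e
    simp [revWeight]
  have hsum : ∀ (h : Hist A E) (a : A), ∑ e : E, revWeight ℓ (h ++ [(a, e)]).reverse =
      revWeight ℓ h.reverse * (1 - ℓ h a) := by
    intro h a
    simp only [hstep, Finset.sum_const, Finset.card_univ, nsmul_eq_mul]
    field_simp
  refine ⟨fun h => revWeight ℓ h.reverse, ⟨fun h => hb _, by simp [revWeight], ?_⟩, ?_⟩
  · intro h a
    rw [hsum]
    exact mul_le_of_le_one_right (hb _).1 (by linarith [(hℓ h a).1])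
  · intro h a hpos
    have hne : revWeight ℓ h.reverse ≠ 0 := ne_of_gt hpos
    unfold measLoss condProb
    rw [← Finset.sum_div, hsum, mul_div_cancel_left₀ _ hne]
    ring
end
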